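/- Let S be a set, g : S×S×S → S, and let f₂ be the transition function of the marching-soldiers automaton over the one-dimensional cellular automaton on ℤ with rule g. Let η be an asynchronous trajectory of f₂, and define τ(x,t) = τ(x,t,η). Let ζ(x,u) be the invariant-history value: ζ(x,u) = η^s(x, t_u) where η^s is the synchronous trajectory of f₂ with initial configuration η(·,0) and t_u is the least t with τ(x,t,η^s) = u (defined whenever such t exists). Define δ : ℤ → ℤ by δ(0) = 0 and δ(x+1) = δ(x) + ((η(x+1,0).Age − η(x,0).Age) amod 3); define τ̄(x,t) = τ(x,t) + δ(x); define the partial function η̄ by η̄(x,u) = ζ(x, u − δ(x)).Cur for every u of the form τ̄(x,t) with t ∈ ℕ, and η̄(x, δ(x)−1) = η(x,0).Prev. Then for every x ∈ ℤ and t ∈ ℕ with τ(x,t) > 0, setting u = τ̄(x,t) − 1, the values η̄(x−1,u), η̄(x,u), η̄(x+1,u), and η̄(x,u+1) are all defined and η̄(x,u+1) = g(η̄(x−1,u), η̄(x,u), η̄(x+1,u)). -/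

import Mathlib

namespace AsyncUpdating

variable {C S : Type*}

/-- `f` is a transition function for the neighborhood function `N`:
`f ξ x` depends only on the restriction of `ξ` to `N x`. -/
def IsTransition (N : C → Set C) (f : (C → S) → C → S) : Prop :=
  ∀ (ξ₁ ξ₂ : C → S) (x : C), (∀ y ∈ N x, ξ₁ y = ξ₂ y) → f ξ₁ x = f ξ₂ x

/-- The automaton is local: every neighborhood is finite. -/
def IsLocal (N : C → Set C) : Prop := ∀ x, (N x).Finite

open Classical in
/-- `upd f ξ E` is the configuration `f(ξ, E)`: apply `f` at the sites of `E` only. -/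
noncomputable def upd (f : (C → S) → C → S) (ξ : C → S) (E : Set C) : C → S :=
  fun x => if x ∈ E then f ξ x else ξ x

/-- The set `L(ξ)` of free sites. -/
def freeSet (f : (C → S) → C → S) (ξ : C → S) : Set C := {x | f ξ x ≠ ξ x}

/-- `η` is an asynchronous trajectory of `f`. -/
def IsAsyncTraj (f : (C → S) → C → S) (η : C → ℕ → S) : Prop :=
  ∀ x t, η x (t + 1) ≠ η x t → η x (t + 1) = f (fun y => η y t) x

/-- `η` is a synchronous trajectory of `f`. -/
def IsSyncTraj (f : (C → S) → C → S) (η : C → ℕ → S) : Prop :=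
  ∀ x t, η x (t + 1) = f (fun y => η y t) x

/-- The synchronous trajectory of `f` with initial configuration `ξ`. -/
def syncTraj (f : (C → S) → C → S) (ξ : C → S) : ℕ → C → S
  | 0 => ξ
  | t + 1 => f (syncTraj f ξ t)

/-- The update set `U(t, η)`. -/
def updSet (η : C → ℕ → S) (t : ℕ) : Set C := {x | η x (t + 1) ≠ η x t}

open Classical in
/-- The effective age `τ(x, t, η)`: the number of `s < t` with `x ∈ U(s, η)`. -/
noncomputable def effAge (η : C → ℕ → S) (x : C) (t : ℕ) : ℕ :=
  ((Finset.range t).filter fun s => η x (s + 1) ≠ η x s).card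

/-- `f` has invariant histories. -/
def InvariantHistories (f : (C → S) → C → S) : Prop :=
  ∀ ξ : C → S, ∃ ζ : C → ℕ → S, ∀ η : C → ℕ → S,
    IsAsyncTraj f η → (∀ x, η x 0 = ξ x) → ∀ x t, η x t = ζ x (effAge η x t)

/-- `f` is monotonic: `L(t,η) \ U(t,η) ⊆ L(t+1,η)` for every asynchronous trajectory. -/
def Monotonic (f : (C → S) → C → S) : Prop :=
  ∀ η : C → ℕ → S, IsAsyncTraj f η → ∀ t,
    freeSet f (fun x => η x t) \ updSet η t ⊆ freeSet f (fun x => η x (t + 1))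

/-- `f` is commutative. -/
def CommutativeRule (f : (C → S) → C → S) : Prop :=
  ∀ (ξ : C → S) (A B : Set C), Disjoint A B →
    A ⊆ freeSet f ξ → B ⊆ freeSet f ξ →
    upd f (upd f ξ A) B = upd f ξ (A ∪ B)

/-- `f` is locally commutative. -/
def LocallyCommutative (f : (C → S) → C → S) : Prop :=
  ∀ (ξ : C → S) (x y : C), x ≠ y → x ∈ freeSet f ξ → y ∈ freeSet f ξ →
    upd f (upd f ξ {x}) {y} = upd f ξ {x, y}

/-- `η₁` dominates `η₀` (they are assumed to have the same initial configuration). -/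
def Dominates (η₁ η₀ : C → ℕ → S) : Prop :=
  (∀ x t, effAge η₀ x t ≤ effAge η₁ x t) ∧
  (∀ x t₀ t₁, effAge η₀ x t₀ = effAge η₁ x t₁ → η₀ x t₀ = η₁ x t₁)

/-- `b amod m`: the integer `x` with `x ≡ b (mod m)` and `-m/2 < x ≤ m/2`. -/
def amod (b m : ℤ) : ℤ := if b % m ≤ m / 2 then b % m else b % m - m

open Classical in
/-- The transition function of the marching-soldiers automaton over `(C, S, N, f₁)`,
with states `(Cur, Prev, Age) : S × S × Fin 3`. -/
noncomputable def march {C S : Type*} (N : C → Set C) (f₁ : (C → S) → C → S)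
    (ξ : C → S × S × Fin 3) (x : C) : S × S × Fin 3 :=
  if ∃ y ∈ N x, amod (((ξ y).2.2.val : ℤ) - ((ξ x).2.2.val : ℤ)) 3 < 0 then ξ x
  else (f₁ (fun y => if (ξ y).2.2 = (ξ x).2.2 then (ξ y).1 else (ξ y).2.1) x,
        (ξ x).1, (ξ x).2.2 + 1)

/-- Neighborhoods of the one-dimensional cellular automaton on `ℤ`. -/
def caN (x : ℤ) : Set ℤ := {x - 1, x, x + 1}

/-- Transition function of the one-dimensional cellular automaton on `ℤ` with rule `g`. -/
def caF {S : Type*} (g : S × S × S → S) (ξ : ℤ → S) (x : ℤ) : S :=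
  g (ξ (x - 1), ξ x, ξ (x + 1))

/-- The synchronous trajectory `ηˢ` of the marching-soldiers automaton over the
one-dimensional cellular automaton with rule `g`, started from `η(·,0)`. -/
noncomputable def msSync {S : Type*} (g : S × S × S → S) (η : ℤ → ℕ → S × S × Fin 3) :
    ℤ → ℕ → S × S × Fin 3 :=
  fun y r => syncTraj (march caN (caF g)) (fun z => η z 0) r y

/-- `msBarEta g η δ x u s` asserts that the partial function `η̄` of STATEMENT 10 is
defined at `(x, u)` with value `s`: either `u = δ(x) − 1` and `s = η(x,0).Prev`, or
`u` is of the form `τ̄(x,t) = τ(x,t) + δ(x)` and `s = ζ(x, u − δ(x)).Cur`, where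
`ζ(x,v) = ηˢ(x, t_v)` with `t_v` the least `t` with `τ(x,t,ηˢ) = v`. -/
noncomputable def msBarEta {S : Type*} (g : S × S × S → S) (η : ℤ → ℕ → S × S × Fin 3)
    (δ : ℤ → ℤ) (x : ℤ) (u : ℤ) (s : S) : Prop :=
  (u = δ x - 1 ∧ s = (η x 0).2.1) ∨
  ((∃ t : ℕ, (effAge η x t : ℤ) + δ x = u) ∧
    ∃ t' : ℕ, (effAge (msSync g η) x t' : ℤ) = u - δ x ∧
      (∀ t'' : ℕ, t'' < t' → (effAge (msSync g η) x t'' : ℤ) ≠ u - δ x) ∧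
      s = (msSync g η x t').1)

section EffectiveAge

variable {η : C → ℕ → S} {x : C} {s t : ℕ}

theorem effAge_zero (η : C → ℕ → S) (x : C) : effAge η x 0 = 0 := by
  simp [effAge]

theorem effAge_succ_of_ne (h : η x (t + 1) ≠ η x t) :
    effAge η x (t + 1) = effAge η x t + 1 := by
  simp [effAge, Finset.range_add_one, Finset.filter_insert, h]

theorem effAge_succ_of_eq (h : η x (t + 1) = η x t) :
    effAge η x (t + 1) = effAge η x t := by
  simp [effAge, Finset.range_add_one, Finset.filter_insert, h]

theorem effAge_mono (η : C → ℕ → S) (x : C) : Monotone (effAge η x) := by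
  refine monotone_nat_of_le_succ fun t => ?_
  by_cases h : η x (t + 1) = η x t
  · rw [effAge_succ_of_eq h]
  · rw [effAge_succ_of_ne h]
    exact Nat.le_succ _

theorem eq_of_effAge_eq_of_le (hst : s ≤ t) (h : effAge η x s = effAge η x t) :
    η x s = η x t := by
  induction t, hst using Nat.le_induction with
  | base => rfl
  | succ t hst ih =>
    have h₁ := effAge_mono η x hst
    by_cases hne : η x (t + 1) = η x t
    · rw [hne]
      exact ih (by rw [h, effAge_succ_of_eq hne])
    · rw [effAge_succ_of_ne hne] at h
      omega

theorem eq_of_effAge_eq (h : effAge η x s = effAge η x t) : η x s = η x t := by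
  rcases le_total s t with hst | hst
  · exact eq_of_effAge_eq_of_le hst h
  · exact (eq_of_effAge_eq_of_le hst h.symm).symm

/-- Every positive effective age that is reached is reached by an update. -/
theorem exists_update_of_lt_effAge {n : ℕ} (h : n < effAge η x t) :
    ∃ r < t, effAge η x r = n ∧ η x (r + 1) ≠ η x r := by
  induction t with
  | zero => simp [effAge_zero] at h
  | succ t ih =>
    by_cases hn : n < effAge η x t
    · obtain ⟨r, hr, h'⟩ := ih hn
      exact ⟨r, hr.trans (Nat.lt_succ_self t), h'⟩
    · have hne : η x (t + 1) ≠ η x t := fun he => hn (effAge_succ_of_eq he ▸ h)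
      rw [effAge_succ_of_ne hne] at h
      exact ⟨t, Nat.lt_succ_self t, by omega, hne⟩

theorem exists_effAge_eq {n : ℕ} (h : n ≤ effAge η x t) : ∃ r, effAge η x r = n := by
  rcases h.lt_or_eq with h | h
  · obtain ⟨r, -, hr, -⟩ := exists_update_of_lt_effAge h
    exact ⟨r, hr⟩
  · exact ⟨t, h.symm⟩

end EffectiveAge

theorem amod_three_eq {d e k : ℤ} (h : d = e + 3 * k) (h₁ : -1 ≤ e) (h₂ : e ≤ 1) :
    amod d 3 = e := by
  unfold amod
  split_ifs <;> omega

theorem amod_three_spec (d : ℤ) :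
    -1 ≤ amod d 3 ∧ amod d 3 ≤ 1 ∧ ∃ k, d = amod d 3 + 3 * k := by
  unfold amod
  split_ifs
  · exact ⟨by omega, by omega, d / 3, by omega⟩
  · exact ⟨by omega, by omega, d / 3 + 1, by omega⟩

section March

variable {N : C → Set C} {f : (C → S) → C → S} {θ : C → ℕ → S × S × Fin 3}

theorem march_ne_iff (ξ : C → S × S × Fin 3) (x : C) :
    march N f ξ x ≠ ξ x ↔
      ∀ y ∈ N x, 0 ≤ amod (((ξ y).2.2.val : ℤ) - ((ξ x).2.2.val : ℤ)) 3 := by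
  unfold march
  split_ifs with h
  · simp only [ne_eq, not_true_eq_false, false_iff]
    intro h'
    obtain ⟨y, hy, hlt⟩ := h
    exact absurd (h' y hy) (not_le.mpr hlt)
  · push Not at h
    refine iff_of_true (fun he => ?_) h
    have h3 : (ξ x).2.2 + 1 = (ξ x).2.2 := congrArg (fun p => p.2.2) he
    revert h3
    generalize (ξ x).2.2 = a
    revert a
    decide

theorem march_eq_of_ne {ξ : C → S × S × Fin 3} {x : C} (h : march N f ξ x ≠ ξ x) :
    march N f ξ x =
      (f (fun y => if (ξ y).2.2 = (ξ x).2.2 then (ξ y).1 else (ξ y).2.1) x,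
        (ξ x).1, (ξ x).2.2 + 1) := by
  unfold march at h ⊢
  split_ifs at h ⊢
  · exact absurd rfl h
  · rfl

namespace IsAsyncTraj

theorem march_update (hθ : IsAsyncTraj (march N f) θ) {x : C} {t : ℕ}
    (h : θ x (t + 1) ≠ θ x t) :
    θ x (t + 1) =
      (f (fun y => if (θ y t).2.2 = (θ x t).2.2 then (θ y t).1 else (θ y t).2.1) x,
        (θ x t).1, (θ x t).2.2 + 1) := by
  have he := hθ x t h
  rw [he] at h ⊢
  exact march_eq_of_ne h

theorem march_age (hθ : IsAsyncTraj (march N f) θ) (x : C) (t : ℕ) :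
    ∃ k : ℤ, ((θ x t).2.2.val : ℤ) = (θ x 0).2.2.val + effAge θ x t + 3 * k := by
  induction t with
  | zero => exact ⟨0, by simp [effAge_zero]⟩
  | succ t ih =>
    obtain ⟨k, hk⟩ := ih
    by_cases h : θ x (t + 1) = θ x t
    · exact ⟨k, by rw [effAge_succ_of_eq h, h, hk]⟩
    · have h₂ : (θ x (t + 1)).2.2 = (θ x t).2.2 + 1 := by rw [hθ.march_update h]
      have h₃ : ∀ a : Fin 3, ((a + 1).val : ℤ) = a.val + 1 ∨
          ((a + 1).val : ℤ) = a.val + 1 + 3 * (-1) := by decide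
      rw [effAge_succ_of_ne h, h₂]
      push_cast
      rcases h₃ (θ x t).2.2 with h' | h'
      · exact ⟨k, by rw [h']; omega⟩
      · exact ⟨k - 1, by rw [h']; omega⟩

theorem march_prev (hθ : IsAsyncTraj (march N f) θ) {x : C} {r t : ℕ}
    (h : effAge θ x t = effAge θ x r + 1) : (θ x t).2.1 = (θ x r).1 := by
  obtain ⟨q, -, hq, hne⟩ :=
    exists_update_of_lt_effAge (h ▸ Nat.lt_succ_self _ : effAge θ x r < effAge θ x t)
  have h₁ : θ x t = θ x (q + 1) := eq_of_effAge_eq (by rw [effAge_succ_of_ne hne, h, hq])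
  rw [h₁, hθ.march_update hne, eq_of_effAge_eq hq]

end IsAsyncTraj

end March

section OneDim

variable {S : Type*} {g : S × S × S → S} {θ η : ℤ → ℕ → S × S × Fin 3} {δ : ℤ → ℤ}

/-- `δ` integrates the age differences of the initial configuration of `θ`. -/
def IsAgePotential (θ : ℤ → ℕ → S × S × Fin 3) (δ : ℤ → ℤ) : Prop :=
  ∀ x : ℤ, δ (x + 1) =
    δ x + amod (((θ (x + 1) 0).2.2.val : ℤ) - ((θ x 0).2.2.val : ℤ)) 3

theorem isAsyncTraj_msSync (g : S × S × S → S) (η : ℤ → ℕ → S × S × Fin 3) :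
    IsAsyncTraj (march caN (caF g)) (msSync g η) :=
  fun _ _ _ => rfl

theorem IsAgePotential.age_sub (hθ : IsAsyncTraj (march caN (caF g)) θ)
    (hδ : IsAgePotential θ δ) (x : ℤ) (t : ℕ) :
    ∃ k : ℤ, ((θ (x + 1) t).2.2.val : ℤ) - (θ x t).2.2.val =
      (effAge θ (x + 1) t + δ (x + 1)) - (effAge θ x t + δ x) + 3 * k := by
  obtain ⟨k₁, h₁⟩ := hθ.march_age (x + 1) t
  obtain ⟨k₂, h₂⟩ := hθ.march_age x t
  obtain ⟨-, -, k₃, h₃⟩ :=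
    amod_three_spec (((θ (x + 1) 0).2.2.val : ℤ) - ((θ x 0).2.2.val : ℤ))
  exact ⟨k₁ - k₂ + k₃, by linarith [hδ x]⟩

theorem IsAgePotential.lipschitz (hθ : IsAsyncTraj (march caN (caF g)) θ)
    (hδ : IsAgePotential θ δ) (x : ℤ) (t : ℕ) :
    -1 ≤ (effAge θ (x + 1) t + δ (x + 1)) - (effAge θ x t + δ x) ∧
      (effAge θ (x + 1) t + δ (x + 1)) - (effAge θ x t + δ x) ≤ 1 := by
  induction t with
  | zero =>
    obtain ⟨h₁, h₂, -⟩ :=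
      amod_three_spec (((θ (x + 1) 0).2.2.val : ℤ) - ((θ x 0).2.2.val : ℤ))
    have := hδ x
    simp only [effAge_zero]
    omega
  | succ t ih =>
    obtain ⟨k, hk⟩ := hδ.age_sub hθ x t
    have hr := amod_three_eq hk ih.1 ih.2
    have hl := amod_three_eq
      (d := ((θ x t).2.2.val : ℤ) - (θ (x + 1) t).2.2.val)
      (e := (effAge θ x t + δ x) - (effAge θ (x + 1) t + δ (x + 1))) (k := -k)
      (by linarith) (by linarith [ih.2]) (by linarith [ih.1])
    have hx : θ x (t + 1) ≠ θ x t →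
        0 ≤ (effAge θ (x + 1) t + δ (x + 1)) - (effAge θ x t + δ x) := fun h => by
      have he := hθ x t h
      have := (march_ne_iff _ _).1 (he ▸ h) (x + 1) (by simp [caN])
      rwa [hr] at this
    have hy : θ (x + 1) (t + 1) ≠ θ (x + 1) t →
        0 ≤ (effAge θ x t + δ x) - (effAge θ (x + 1) t + δ (x + 1)) := fun h => by
      have he := hθ (x + 1) t h
      have := (march_ne_iff _ _).1 (he ▸ h) x (by simp [caN])
      rwa [hl] at this
    by_cases h₁ : θ x (t + 1) = θ x t <;> by_cases h₂ : θ (x + 1) (t + 1) = θ (x + 1) t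
    · rw [effAge_succ_of_eq h₁, effAge_succ_of_eq h₂]
      exact ih
    · have := hy h₂
      rw [effAge_succ_of_eq h₁, effAge_succ_of_ne h₂]
      omega
    · have := hx h₁
      rw [effAge_succ_of_ne h₁, effAge_succ_of_eq h₂]
      omega
    · rw [effAge_succ_of_ne h₁, effAge_succ_of_ne h₂]
      omega

/-- On a neighborhood, `τ̄` differs by at most one, and its differences are the
age differences modulo `3`. -/
theorem IsAgePotential.neighbor (hθ : IsAsyncTraj (march caN (caF g)) θ)
    (hδ : IsAgePotential θ δ) {x y : ℤ} (hy : y ∈ caN x) (t : ℕ) :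
    -1 ≤ (effAge θ y t + δ y) - (effAge θ x t + δ x) ∧
      (effAge θ y t + δ y) - (effAge θ x t + δ x) ≤ 1 ∧
      amod (((θ y t).2.2.val : ℤ) - (θ x t).2.2.val) 3 =
        (effAge θ y t + δ y) - (effAge θ x t + δ x) := by
  rcases hy with rfl | rfl | rfl
  · have hL := hδ.lipschitz hθ (x - 1) t
    obtain ⟨k, hk⟩ := hδ.age_sub hθ (x - 1) t
    rw [sub_add_cancel] at hL hk
    refine ⟨by linarith [hL.2], by linarith [hL.1], ?_⟩
    exact amod_three_eq (k := -k) (by linarith) (by linarith [hL.2]) (by linarith [hL.1])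
  · refine ⟨by omega, by omega, ?_⟩
    exact amod_three_eq (k := 0) (by ring) (by omega) (by omega)
  · have hL := hδ.lipschitz hθ x t
    obtain ⟨k, hk⟩ := hδ.age_sub hθ x t
    exact ⟨hL.1, hL.2, amod_three_eq hk hL.1 hL.2⟩

theorem IsAgePotential.le_of_update (hθ : IsAsyncTraj (march caN (caF g)) θ)
    (hδ : IsAgePotential θ δ) {x y : ℤ} (hy : y ∈ caN x) {t : ℕ}
    (h : θ x (t + 1) ≠ θ x t) : effAge θ x t + δ x ≤ effAge θ y t + δ y := by
  have he := hθ x t h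
  have h₁ := (march_ne_iff _ _).1 (he ▸ h) y hy
  rw [(hδ.neighbor hθ hy t).2.2] at h₁
  linarith

theorem IsAgePotential.msSync (hδ : IsAgePotential η δ) : IsAgePotential (msSync g η) δ :=
  hδ

/-- The synchronous trajectory dominates every asynchronous one. -/
theorem effAge_le_effAge_msSync (hη : IsAsyncTraj (march caN (caF g)) η)
    (hδ : IsAgePotential η δ) (x : ℤ) (t : ℕ) :
    effAge η x t ≤ effAge (msSync g η) x t := by
  induction t generalizing x with
  | zero => simp [effAge_zero]
  | succ t ih =>
    by_cases h : η x (t + 1) = η x t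
    · rw [effAge_succ_of_eq h]
      exact (ih x).trans (effAge_mono _ _ t.le_succ)
    · rw [effAge_succ_of_ne h]
      rcases (ih x).lt_or_eq with hlt | heq
      · exact hlt.trans_le (effAge_mono _ _ t.le_succ)
      · have hne : msSync g η x (t + 1) ≠ msSync g η x t := by
          refine (march_ne_iff (fun y => msSync g η y t) x).2 fun y hy => ?_
          rw [((hδ.msSync (g := g)).neighbor (isAsyncTraj_msSync g η) hy t).2.2]
          have := hδ.le_of_update hη hy h
          have := ih y
          omega
        rw [effAge_succ_of_ne hne, heq]

theorem msBarEta_of_effAge {x u : ℤ} {t r : ℕ} (ht : u ≤ effAge η x t + δ x)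
    (hr : (effAge (msSync g η) x r : ℤ) + δ x = u) :
    msBarEta g η δ x u (msSync g η x r).1 := by
  classical
  refine Or.inr ⟨?_, ?_⟩
  · obtain ⟨q, hq⟩ := exists_effAge_eq (η := η) (x := x) (t := t)
      (n := effAge (msSync g η) x r) (by omega)
    exact ⟨q, by rw [hq, hr]⟩
  · have hex : ∃ q, effAge (msSync g η) x q = effAge (msSync g η) x r := ⟨r, rfl⟩
    refine ⟨Nat.find hex, ?_, fun q hq => ?_, ?_⟩
    · rw [Nat.find_spec hex]
      omega
    · have := Nat.find_min hex hq
      omega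
    · rw [eq_of_effAge_eq (Nat.find_spec hex)]

/-- The value read off a neighbor `y` by an update of `x` in the synchronous trajectory
is the value of `η̄` at `y`. -/
theorem msBarEta_neighbor (hη : IsAsyncTraj (march caN (caF g)) η)
    (hδ : IsAgePotential η δ) {x y u : ℤ} (hy : y ∈ caN x) {t r : ℕ}
    (ht : effAge η x t + δ x = u + 1)
    (hr : (effAge (msSync g η) x r : ℤ) + δ x = u)
    (hne : msSync g η x (r + 1) ≠ msSync g η x r) :
    msBarEta g η δ y u
      (if (msSync g η y r).2.2 = (msSync g η x r).2.2 then (msSync g η y r).1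
        else (msSync g η y r).2.1) := by
  have hθ := isAsyncTraj_msSync g η
  have hδs := hδ.msSync (g := g)
  have hle := hδs.le_of_update hθ hy hne
  obtain ⟨-, hub, hmod⟩ := hδs.neighbor hθ hy r
  have hyt := (hδ.neighbor hη hy t).1
  split_ifs with hage
  · rw [hage, sub_self] at hmod
    have h0 : amod 0 3 = 0 := by decide
    exact msBarEta_of_effAge (t := t) (by omega) (by omega)
  · have hlead : (effAge (msSync g η) y r : ℤ) + δ y = u + 1 := by
      by_contra hcon
      have he : (effAge (msSync g η) y r + δ y) - (effAge (msSync g η) x r + δ x) = (0 : ℤ) := by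
        omega
      obtain ⟨-, -, k, hk⟩ := amod_three_spec
        (((msSync g η y r).2.2.val : ℤ) - (msSync g η x r).2.2.val)
      rw [hmod, he] at hk
      exact hage (Fin.ext (by omega))
    rcases Nat.eq_zero_or_pos (effAge (msSync g η) y r) with h0 | hpos
    · have : msSync g η y r = η y 0 :=
        (eq_of_effAge_eq (h0.trans (effAge_zero _ _).symm) : _ = msSync g η y 0)
      exact Or.inl ⟨by omega, by rw [this]⟩
    · obtain ⟨q, -, hq, -⟩ := exists_update_of_lt_effAge
        (Nat.sub_lt hpos one_pos : effAge (msSync g η) y r - 1 < effAge (msSync g η) y r)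
      rw [hθ.march_prev (r := q) (by omega)]
      exact msBarEta_of_effAge (t := t) (by omega) (by omega)

end OneDim

/-- for any asynchronous trajectory `η` of the marching-soldiers
automaton over the one-dimensional cellular automaton with rule `g`, with `δ` defined by
`δ(0) = 0`, `δ(x+1) = δ(x) + ((η(x+1,0).Age − η(x,0).Age) amod 3)`, whenever
`τ(x,t) > 0` and `u = τ(x,t) + δ(x) − 1`, the values `η̄(x−1,u)`, `η̄(x,u)`,
`η̄(x+1,u)`, `η̄(x,u+1)` are all defined and
`η̄(x,u+1) = g(η̄(x−1,u), η̄(x,u), η̄(x+1,u))`. -/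
theorem march_oneDim_reconstruction
    {S : Type*} (g : S × S × S → S)
    (η : ℤ → ℕ → S × S × Fin 3) (hη : IsAsyncTraj (march caN (caF g)) η)
    (δ : ℤ → ℤ) (hδ0 : δ 0 = 0)
    (hδ : ∀ x : ℤ, δ (x + 1) =
      δ x + amod (((η (x + 1) 0).2.2.val : ℤ) - ((η x 0).2.2.val : ℤ)) 3) :
    ∀ (x : ℤ) (t : ℕ), 0 < effAge η x t →
      ∃ a b c d : S,
        msBarEta g η δ (x - 1) ((effAge η x t : ℤ) + δ x - 1) a ∧
        msBarEta g η δ x ((effAge η x t : ℤ) + δ x - 1) b ∧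
        msBarEta g η δ (x + 1) ((effAge η x t : ℤ) + δ x - 1) c ∧
        msBarEta g η δ x ((effAge η x t : ℤ) + δ x) d ∧
        d = g (a, b, c) := by
  intro x t ht
  have hp : IsAgePotential η δ := hδ
  have hθ := isAsyncTraj_msSync g η
  obtain ⟨r, -, hr, hne⟩ := exists_update_of_lt_effAge
    ((Nat.sub_lt ht one_pos).trans_le (effAge_le_effAge_msSync hη hp x t))
  have hbar {y : ℤ} (hy : y ∈ caN x) :=
    msBarEta_neighbor hη hp hy (u := effAge η x t + δ x - 1) (t := t) (by omega)
      (by omega) hne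
  refine ⟨_, _, _, (msSync g η x (r + 1)).1, hbar (by simp [caN]), hbar (by simp [caN]),
    hbar (by simp [caN]), msBarEta_of_effAge (t := t) le_rfl ?_, ?_⟩
  · rw [effAge_succ_of_ne hne]
    omega
  · rw [hθ.march_update hne]
    rfl

end AsyncUpdating
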